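/- Let G be a locally finite, connected metric graph with finite total length L > 0, finite diameter D > 0, and finite Betti number. Then the first nontrivial eigenvalue of the Neumann extension satisfies μ_2(G) ≤ (π²/D²) · (4L − 3D)/D. -/

import Mathlib

open MeasureTheory Set Filter
open scoped ENNReal

/-- A metric graph structure on a metric space `X`: a countable collection of edges,
each parametrised by arc length over `[0, len e]`, together with vertices identified
with edge endpoints; the interiors of distinct edges are disjoint, the edges cover `X`,
and the metric of `X` is the induced path metric (characterised by the fact that the
edge parametrisations are `1`-Lipschitz and `dist x y` is the largest value `u x - u y`
over all continuous, edgewise `1`-Lipschitz functions `u : X → ℝ`). -/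
structure MetricGraphOn (X : Type) [MetricSpace X] where
  V : Type
  E : Type
  countableV : Countable V
  countableE : Countable E
  len : E → ℝ
  len_pos : ∀ e, 0 < len e
  edgeMap : E → ℝ → X
  vertexMap : V → X
  endpoint : E → Bool → V
  edgeMap_cont : ∀ e, ContinuousOn (edgeMap e) (Icc 0 (len e))
  edgeMap_injOn : ∀ e, InjOn (edgeMap e) (Ico 0 (len e))
  edgeMap_zero : ∀ e, edgeMap e 0 = vertexMap (endpoint e false)
  edgeMap_len : ∀ e, edgeMap e (len e) = vertexMap (endpoint e true)
  interior_disjoint : ∀ e e', e ≠ e' → ∀ s ∈ Ioo 0 (len e), ∀ t ∈ Ioo 0 (len e'),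
    edgeMap e s ≠ edgeMap e' t
  interior_not_vertex : ∀ e, ∀ s ∈ Ioo 0 (len e), ∀ v, edgeMap e s ≠ vertexMap v
  vertexMap_inj : Function.Injective vertexMap
  cover : ∀ x : X, ∃ e, ∃ t ∈ Icc 0 (len e), edgeMap e t = x
  dist_le : ∀ e, ∀ s ∈ Icc 0 (len e), ∀ t ∈ Icc 0 (len e),
    dist (edgeMap e s) (edgeMap e t) ≤ |s - t|
  dist_ge : ∀ u : X → ℝ, Continuous u →
    (∀ e, ∀ s ∈ Icc 0 (len e), ∀ t ∈ Icc 0 (len e),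
      |u (edgeMap e s) - u (edgeMap e t)| ≤ |s - t|) →
    ∀ x y, u x - u y ≤ dist x y

namespace MetricGraphOn

variable {X : Type} [MetricSpace X]

/-- The (a.e. defined) derivative of `f` along the edge `e`, in the arc-length
parametrisation of the edge. -/
noncomputable def edgeDeriv (G : MetricGraphOn X) (f : X → ℝ) (e : G.E) : ℝ → ℝ :=
  deriv (f ∘ G.edgeMap e)

/-- The subset of `X` consisting of the (closed) edges in `A`. -/
def subgraphSet (G : MetricGraphOn X) (A : Set G.E) : Set X :=
  ⋃ e ∈ A, G.edgeMap e '' Icc 0 (G.len e)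

/-- `∫_e |f|²` along a single edge. -/
noncomputable def edgeMass (G : MetricGraphOn X) (f : X → ℝ) (e : G.E) : ℝ :=
  ∫ t in Ioo 0 (G.len e), (f (G.edgeMap e t)) ^ 2

/-- `∫_e |f'|²` along a single edge. -/
noncomputable def edgeEnergy (G : MetricGraphOn X) (f : X → ℝ) (e : G.E) : ℝ :=
  ∫ t in Ioo 0 (G.len e), (G.edgeDeriv f e t) ^ 2

/-- Membership in the Sobolev space `H¹` of the subgraph given by the edge set `A`:
continuity on the subgraph, edgewise absolute continuity with square-integrable
derivative, and finiteness of the total `H¹` norm. -/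
def MemH1On (G : MetricGraphOn X) (A : Set G.E) (f : X → ℝ) : Prop :=
  ContinuousOn f (G.subgraphSet A) ∧
  (∀ e ∈ A, IntegrableOn (fun t => (G.edgeDeriv f e t) ^ 2) (Ioo 0 (G.len e))) ∧
  (∀ e ∈ A, ∀ t ∈ Icc (0:ℝ) (G.len e),
    f (G.edgeMap e t) = f (G.edgeMap e 0) + ∫ s in Ioo 0 t, G.edgeDeriv f e s) ∧
  Summable (fun e : A => G.edgeMass f (e : G.E) + G.edgeEnergy f (e : G.E))

/-- Membership in `H¹(G)`. -/
def MemH1 (G : MetricGraphOn X) (f : X → ℝ) : Prop :=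
  Continuous f ∧ G.MemH1On Set.univ f

/-- The squared `L²` norm of `f` over the edges in `A`. -/
noncomputable def l2normSqOn (G : MetricGraphOn X) (A : Set G.E) (f : X → ℝ) : ℝ :=
  ∑' e : A, G.edgeMass f (e : G.E)

/-- The squared `L²` norm of `f'` over the edges in `A`. -/
noncomputable def derivNormSqOn (G : MetricGraphOn X) (A : Set G.E) (f : X → ℝ) : ℝ :=
  ∑' e : A, G.edgeEnergy f (e : G.E)

/-- The squared `L²` norm of `f` on `G`. -/
noncomputable def l2normSq (G : MetricGraphOn X) (f : X → ℝ) : ℝ :=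
  G.l2normSqOn Set.univ f

/-- The squared `L²` norm of `f'` on `G` (the Dirichlet energy of `f`). -/
noncomputable def derivNormSq (G : MetricGraphOn X) (f : X → ℝ) : ℝ :=
  G.derivNormSqOn Set.univ f

/-- The squared `H¹` norm of `f`. -/
noncomputable def h1normSq (G : MetricGraphOn X) (f : X → ℝ) : ℝ :=
  G.l2normSq f + G.derivNormSq f

/-- The `L²` inner product on `G`. -/
noncomputable def l2inner (G : MetricGraphOn X) (f g : X → ℝ) : ℝ :=
  ∑' e : G.E, ∫ t in Ioo 0 (G.len e), f (G.edgeMap e t) * g (G.edgeMap e t)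

/-- The Dirichlet form (inner product of derivatives) on `G`. -/
noncomputable def derivInner (G : MetricGraphOn X) (f g : X → ℝ) : ℝ :=
  ∑' e : G.E, ∫ t in Ioo 0 (G.len e), G.edgeDeriv f e t * G.edgeDeriv g e t

/-- The `k`-th min-max (Courant–Fischer) value of the quadratic form
`f ↦ ∫ |f'|²` (over the edges of `A`) with form domain `K`: the infimum over all
`k`-dimensional subspaces of `K` of the largest Rayleigh quotient on the subspace.
For a self-adjoint Laplacian with purely discrete spectrum this is its `k`-th
eigenvalue (`k = 1` giving the lowest one). -/
noncomputable def eigenOn (G : MetricGraphOn X) (A : Set G.E) (K : Set (X → ℝ))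
    (k : ℕ) : ℝ :=
  sInf { μ : ℝ | ∃ φ : Fin k → X → ℝ, (∀ i, φ i ∈ K) ∧
    LinearIndependent ℝ (fun i => (G.subgraphSet A).restrict (φ i)) ∧
    ∀ c : Fin k → ℝ,
      G.derivNormSqOn A (∑ i, c i • φ i) ≤ μ * G.l2normSqOn A (∑ i, c i • φ i) }

/-- The `k`-th eigenvalue `μ_k(G)` of the Neumann extension (standard
continuity–Kirchhoff conditions at all vertices, Neumann conditions at all ends). -/
noncomputable def neumannEigen (G : MetricGraphOn X) (k : ℕ) : ℝ :=
  G.eigenOn Set.univ {f | G.MemH1 f} k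

/-- `f` vanishes at the point `y` of the completion of `X`. -/
def VanishesAt (f : X → ℝ) (y : UniformSpace.Completion X) : Prop :=
  Tendsto f (comap ((↑) : X → UniformSpace.Completion X) (nhds y)) (nhds 0)

/-- Membership in `H¹₀(G; 𝔙)`: `H¹`-functions vanishing on the set `𝔙` of
vertices and/or ends (viewed inside the completion of `X`). -/
def H10Mem (G : MetricGraphOn X) (𝔙 : Set (UniformSpace.Completion X))
    (f : X → ℝ) : Prop :=
  G.MemH1 f ∧ ∀ y ∈ 𝔙, VanishesAt f y

/-- The `k`-th eigenvalue `λ_k(G; 𝔙)` of the Laplacian with Dirichlet conditions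
on `𝔙` and standard (continuity–Kirchhoff/Neumann) conditions elsewhere. -/
noncomputable def dirichletEigen (G : MetricGraphOn X)
    (𝔙 : Set (UniformSpace.Completion X)) (k : ℕ) : ℝ :=
  G.eigenOn Set.univ {f | G.H10Mem 𝔙 f} k

/-- The set of (topological = graph) ends of `G`, realised as the points of the
completion of `X` that do not belong to `X`. -/
def Ends (_G : MetricGraphOn X) : Set (UniformSpace.Completion X) :=
  {y | y ∉ Set.range ((↑) : X → UniformSpace.Completion X)}

/-- The set of vertices of `G`, viewed inside the completion of `X`. -/
def vertexPoints (G : MetricGraphOn X) : Set (UniformSpace.Completion X) :=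
  Set.range (fun v => ((G.vertexMap v : X) : UniformSpace.Completion X))

/-- The degree of a vertex (loops counted twice). -/
noncomputable def degree (G : MetricGraphOn X) (v : G.V) : ℕ :=
  {p : G.E × Bool | G.endpoint p.1 p.2 = v}.ncard

/-- `G` is locally finite: every vertex has finite degree. -/
def LocallyFinite (G : MetricGraphOn X) : Prop :=
  ∀ v : G.V, {p : G.E × Bool | G.endpoint p.1 p.2 = v}.Finite

/-- A cycle in `G`: a compact subset homeomorphic to a circle. -/
def IsCycle (_G : MetricGraphOn X) (C : Set X) : Prop :=
  IsCompact C ∧ Nonempty (C ≃ₜ Metric.sphere (0 : ℝ × ℝ) 1)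

/-- `G` has (first) Betti number `β`: there is a minimal finite family of `β` cycles
whose union contains every cycle of `G`. -/
def HasBettiNumber (G : MetricGraphOn X) (β : ℕ) : Prop :=
  ∃ 𝒞 : Finset (Set X), 𝒞.card = β ∧ (∀ C ∈ 𝒞, G.IsCycle C) ∧
    (∀ C, G.IsCycle C → C ⊆ ⋃ C' ∈ 𝒞, C') ∧
    ∀ 𝒞' : Finset (Set X), (∀ C ∈ 𝒞', G.IsCycle C) →
      (∀ C, G.IsCycle C → C ⊆ ⋃ C' ∈ 𝒞', C') → β ≤ 𝒞'.card

/-- The embedding of `K ⊆ H¹(G)` into `L²(G)` is compact: every sequence in `K`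
bounded in the `H¹` norm has a subsequence which is Cauchy in the `L²` norm. -/
def CompactlyEmbedded (G : MetricGraphOn X) (K : Set (X → ℝ)) : Prop :=
  ∀ u : ℕ → X → ℝ, (∀ n, u n ∈ K) → (∀ n, G.h1normSq (u n) ≤ 1) →
    ∃ φ : ℕ → ℕ, StrictMono φ ∧
      ∀ ε : ℝ, 0 < ε → ∃ N, ∀ m, N ≤ m → ∀ n, N ≤ n →
        G.l2normSq (u (φ m) - u (φ n)) ≤ ε

/-- The self-adjoint operator with form `f ↦ ∫ |f'|²` and form domain `K` has
purely discrete spectrum (equivalently, compact resolvent): its min-max values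
tend to `+∞`. -/
def HasPurelyDiscreteSpectrumOn (G : MetricGraphOn X) (K : Set (X → ℝ)) : Prop :=
  Tendsto (fun k => G.eigenOn Set.univ K k) atTop atTop

/-- The volume (total length) of a subset `S` of `G`. -/
noncomputable def vol (G : MetricGraphOn X) (S : Set X) : ℝ≥0∞ :=
  ∑' e : G.E, volume (G.edgeMap e ⁻¹' S ∩ Ioo 0 (G.len e))

/-- The set of vertices incident to some edge in `A`. -/
def vertexSetOf (G : MetricGraphOn X) (A : Set G.E) : Set G.V :=
  {v | ∃ e ∈ A, ∃ b, G.endpoint e b = v}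

/-- Membership in `H¹₀(G)`, the closure in `H¹(G)` of the compactly supported
`H¹` functions (the form domain of the Friedrichs extension). -/
def H100Mem (G : MetricGraphOn X) (f : X → ℝ) : Prop :=
  G.MemH1 f ∧ ∃ u : ℕ → X → ℝ, (∀ n, G.MemH1 (u n) ∧ HasCompactSupport (u n)) ∧
    Tendsto (fun n => G.h1normSq (f - u n)) atTop (nhds 0)

/-- The `k`-th eigenvalue `λ_k(G)` of the Friedrichs extension. -/
noncomputable def friedrichsEigen (G : MetricGraphOn X) (k : ℕ) : ℝ :=
  G.eigenOn Set.univ {f | G.H100Mem f} k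

end MetricGraphOn

theorem lintegral_le_tsum_lintegral_comp {ι : Type*} [Countable ι] {len : ι → ℝ}
    {w : ι → ℝ → ℝ} {s : Set ℝ} (hw : ∀ i, LipschitzOnWith 1 (w i) (Icc 0 (len i)))
    (hcov : s ⊆ ⋃ i, w i '' Icc 0 (len i)) {g : ℝ → ℝ≥0∞} (hg : Measurable g) :
    ∫⁻ x in s, g x ≤ ∑' i, ∫⁻ t in Ioo 0 (len i), g (w i t) := by
  have hwm : ∀ i, AEMeasurable (w i) (volume.restrict (Ioo 0 (len i))) := fun i =>
    ((hw i).continuousOn.mono Ioo_subset_Icc_self).aemeasurable measurableSet_Ioo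
  have hle : volume.restrict s ≤
      Measure.sum fun i => (volume.restrict (Ioo 0 (len i))).map (w i) := by
    refine Measure.le_iff.2 fun A hA => ?_
    rw [Measure.restrict_apply hA, Measure.sum_apply _ hA]
    have hsub : A ∩ s ⊆ ⋃ i, w i '' (w i ⁻¹' A ∩ Icc 0 (len i)) := by
      rintro x ⟨hxA, hxs⟩
      obtain ⟨i, t, ht, rfl⟩ := mem_iUnion.1 (hcov hxs)
      exact mem_iUnion.2 ⟨i, t, ⟨hxA, ht⟩, rfl⟩
    refine (measure_mono hsub).trans ((measure_iUnion_le _).trans (ENNReal.tsum_le_tsum fun i => ?_))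
    rw [Measure.map_apply_of_aemeasurable (hwm i) hA, restrict_Ioo_eq_restrict_Icc,
      Measure.restrict_apply' measurableSet_Icc]
    simpa [hausdorffMeasure_real] using
      ((hw i).mono inter_subset_right).hausdorffMeasure_image_le (d := 1) zero_le_one
  calc ∫⁻ x in s, g x
      ≤ ∫⁻ x, g x ∂(Measure.sum fun i => (volume.restrict (Ioo 0 (len i))).map (w i)) :=
        lintegral_mono' hle le_rfl
    _ = ∑' i, ∫⁻ t in Ioo 0 (len i), g (w i t) := by
        rw [lintegral_sum_measure]
        exact tsum_congr fun i => lintegral_map' hg.aemeasurable (hwm i)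

theorem integrableOn_comp_of_lipschitzOnWith {l : ℝ} {w g : ℝ → ℝ}
    (hw : LipschitzOnWith 1 w (Icc 0 l)) (hg : Measurable g) (hg0 : ∀ x, 0 ≤ g x)
    (hg1 : ∀ x, g x ≤ 1) : IntegrableOn (fun t => g (w t)) (Ioo 0 l) := by
  have hwm : AEMeasurable w (volume.restrict (Ioo 0 l)) :=
    (hw.continuousOn.mono Ioo_subset_Icc_self).aemeasurable measurableSet_Ioo
  refine Integrable.of_bound (hg.comp_aemeasurable hwm).aestronglyMeasurable 1
    (ae_of_all _ fun t => ?_)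
  simpa [abs_of_nonneg (hg0 _)] using hg1 (w t)

theorem summable_setIntegral_Ioo {ι : Type*} {len : ι → ℝ} (hlen : ∀ i, 0 < len i)
    (hsum : Summable len) {f : ι → ℝ → ℝ} {C : ℝ} (h0 : ∀ i, ∀ t ∈ Ioo 0 (len i), 0 ≤ f i t)
    (h1 : ∀ i, ∀ t ∈ Ioo 0 (len i), f i t ≤ C) :
    Summable fun i => ∫ t in Ioo 0 (len i), f i t := by
  refine Summable.of_nonneg_of_le (fun i => setIntegral_nonneg measurableSet_Ioo (h0 i))
    (fun i => ?_) (hsum.mul_left C)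
  have := norm_setIntegral_le_of_norm_le_const (μ := volume) (s := Ioo 0 (len i)) (f := f i)
    (C := C) (by simp) fun t ht => by
      rw [Real.norm_of_nonneg (h0 i t ht)]; exact h1 i t ht
  simpa [(hlen i).le] using (le_abs_self _).trans this

theorem setIntegral_le_tsum_setIntegral_comp {ι : Type*} [Countable ι] {len : ι → ℝ}
    (hlen : ∀ i, 0 < len i) (hsum : Summable len) {w : ι → ℝ → ℝ} {s : Set ℝ}
    (hs : volume s ≠ ∞) (hw : ∀ i, LipschitzOnWith 1 (w i) (Icc 0 (len i)))
    (hcov : s ⊆ ⋃ i, w i '' Icc 0 (len i)) {g : ℝ → ℝ} (hg : Measurable g)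
    (hg0 : ∀ x, 0 ≤ g x) (hg1 : ∀ x, g x ≤ 1) :
    ∫ x in s, g x ≤ ∑' i, ∫ t in Ioo 0 (len i), g (w i t) := by
  have hnn : ∀ i, 0 ≤ ∫ t in Ioo 0 (len i), g (w i t) := fun i => integral_nonneg fun t => hg0 _
  have : IsFiniteMeasure (volume.restrict s) := ⟨by simpa using hs.lt_top⟩
  have hgs : Integrable g (volume.restrict s) :=
    Integrable.of_bound hg.aestronglyMeasurable 1
      (ae_of_all _ fun t => by simpa [abs_of_nonneg (hg0 _)] using hg1 t)
  rw [← ENNReal.ofReal_le_ofReal_iff (tsum_nonneg hnn),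
    ENNReal.ofReal_tsum_of_nonneg hnn (summable_setIntegral_Ioo hlen hsum (C := 1)
      (fun i t _ => hg0 _) fun i t _ => hg1 _),
    ofReal_integral_eq_lintegral_ofReal hgs (ae_of_all _ hg0)]
  refine (lintegral_le_tsum_lintegral_comp hw hcov hg.ennreal_ofReal).trans
    (ENNReal.tsum_le_tsum fun i => le_of_eq ?_)
  exact (ofReal_integral_eq_lintegral_ofReal
    (integrableOn_comp_of_lipschitzOnWith (hw i) hg hg0 hg1) (ae_of_all _ fun t => hg0 _)).symm

theorem abs_deriv_comp_le_of_lipschitzOnWith {h w : ℝ → ℝ} {s : Set ℝ} {t : ℝ}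
    (hw : LipschitzOnWith 1 w s) (hs : s ∈ nhds t) (hh : DifferentiableAt ℝ h (w t)) :
    |deriv (h ∘ w) t| ≤ |deriv h (w t)| := by
  refine le_of_forall_pos_le_add fun ε hε => ?_
  refine norm_deriv_le_of_lip' (𝕜 := ℝ) (f := h ∘ w) (by positivity) ?_
  have hcont : ContinuousAt w t := hw.continuousOn.continuousAt hs
  filter_upwards [hcont.eventually (hh.hasDerivAt.isLittleO.bound hε), hs] with x hx hxs
  have hlip : |w x - w t| ≤ |x - t| := by
    simpa [Real.dist_eq] using hw.dist_le_mul x hxs t (mem_of_mem_nhds hs)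
  simp only [Real.norm_eq_abs, smul_eq_mul, Function.comp] at hx ⊢
  calc |h (w x) - h (w t)|
      ≤ |h (w x) - h (w t) - (w x - w t) * deriv h (w t)| + |(w x - w t) * deriv h (w t)| := by
        simpa using abs_add_le (h (w x) - h (w t) - (w x - w t) * deriv h (w t))
          ((w x - w t) * deriv h (w t))
    _ ≤ (|deriv h (w t)| + ε) * |w x - w t| := by rw [abs_mul]; linarith
    _ ≤ _ := by gcongr

/-- The positive part of `t ↦ cos (π t / d)`. -/
noncomputable def cosBump (d t : ℝ) : ℝ := max (Real.cos (Real.pi / d * t)) 0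

theorem cosBump_nonneg (d t : ℝ) : 0 ≤ cosBump d t := le_max_right _ _

theorem cosBump_le_one (d t : ℝ) : cosBump d t ≤ 1 := max_le (Real.cos_le_one _) zero_le_one

theorem continuous_cosBump (d : ℝ) : Continuous (cosBump d) := by
  unfold cosBump; fun_prop

theorem abs_cosBump_sub_cosBump_le {d : ℝ} (hd : 0 < d) (s t : ℝ) :
    |cosBump d s - cosBump d t| ≤ Real.pi / d * |s - t| := by
  calc |cosBump d s - cosBump d t|
      ≤ |Real.cos (Real.pi / d * s) - Real.cos (Real.pi / d * t)| := abs_max_sub_max_le_abs _ _ _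
    _ ≤ |Real.pi / d * s - Real.pi / d * t| := Real.abs_cos_sub_cos_le _ _
    _ = Real.pi / d * |s - t| := by
        rw [← mul_sub, abs_mul, abs_of_pos (div_pos Real.pi_pos hd)]

theorem cosBump_eq_cos {d t : ℝ} (hd : 0 < d) (h0 : 0 ≤ t) (h1 : t ≤ d / 2) :
    cosBump d t = Real.cos (Real.pi / d * t) := by
  have hpi := Real.pi_pos
  have h2 : Real.pi / d * t ≤ Real.pi / 2 := by
    calc Real.pi / d * t ≤ Real.pi / d * (d / 2) := by gcongr
      _ = Real.pi / 2 := by field_simp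
  have h3 : 0 ≤ Real.pi / d * t := by positivity
  exact max_eq_left (Real.cos_nonneg_of_mem_Icc ⟨by linarith, h2⟩)

theorem cosBump_eq_zero {d t : ℝ} (hd : 0 < d) (h0 : d / 2 ≤ t) (h1 : t ≤ d) :
    cosBump d t = 0 := by
  have hpi := Real.pi_pos
  have h2 : Real.pi / 2 ≤ Real.pi / d * t := by
    calc Real.pi / 2 = Real.pi / d * (d / 2) := by field_simp
      _ ≤ Real.pi / d * t := by gcongr
  have h3 : Real.pi / d * t ≤ Real.pi := by
    calc Real.pi / d * t ≤ Real.pi / d * d := by gcongr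
      _ = Real.pi := by field_simp
  exact max_eq_right (Real.cos_nonpos_of_pi_div_two_le_of_le h2 (by linarith))

theorem integral_cosBump_sq {d : ℝ} (hd : 0 < d) :
    d / 4 ≤ ∫ t in Icc 0 d, cosBump d t ^ 2 := by
  have hint : ∀ s : ℝ, IntegrableOn (fun t => cosBump d t ^ 2) (Icc 0 s) := fun s =>
    ((continuous_cosBump d).pow 2).continuousOn.integrableOn_Icc
  have hsub : ∫ t in Icc 0 (d / 2), cosBump d t ^ 2 ≤ ∫ t in Icc 0 d, cosBump d t ^ 2 :=
    setIntegral_mono_set (hint d) (ae_of_all _ fun t => sq_nonneg _)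
      (Icc_subset_Icc_right (by linarith)).eventuallyLE
  refine le_trans (le_of_eq ?_) hsub
  have hpi : Real.pi / d ≠ 0 := (div_pos Real.pi_pos hd).ne'
  have hend : Real.pi / d * (d / 2) = Real.pi / 2 := by field_simp
  have : ∫ t in Icc 0 (d / 2), cosBump d t ^ 2 = ∫ t in (0 : ℝ)..d / 2,
      Real.cos (Real.pi / d * t) ^ 2 := by
    rw [intervalIntegral.integral_of_le (by linarith), ← integral_Icc_eq_integral_Ioc]
    exact setIntegral_congr_fun measurableSet_Icc fun t ht => by
      simp only [cosBump_eq_cos hd ht.1 ht.2]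
  rw [this, intervalIntegral.integral_comp_mul_left (fun x => Real.cos x ^ 2) hpi,
    integral_cos_sq, hend]
  have := Real.pi_ne_zero
  simp
  field_simp
  norm_num

theorem deriv_cosBump_comp_eq_zero {d t : ℝ} {w : ℝ → ℝ}
    (h : cosBump d (w t) = 0) : deriv (cosBump d ∘ w) t = 0 := by
  refine IsLocalMin.deriv_eq_zero (Eventually.of_forall fun x => ?_)
  simpa [h] using cosBump_nonneg d (w x)

theorem sq_deriv_cosBump_comp_le {d l t : ℝ} {w : ℝ → ℝ} (hd : 0 < d)
    (hw : LipschitzOnWith 1 w (Icc 0 l)) (ht : t ∈ Ioo 0 l) (h0 : ∀ x ∈ Icc 0 l, 0 ≤ w x)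
    (h1 : w t ≤ d) :
    deriv (cosBump d ∘ w) t ^ 2 ≤ (Real.pi / d) ^ 2 *
      (1 - (Icc (d / 2) d).indicator 1 (w t) - cosBump d (w t) ^ 2) := by
  have hnhds : Icc 0 l ∈ nhds t := Icc_mem_nhds ht.1 ht.2
  rcases le_or_gt (d / 2) (w t) with h | h
  · have hz := cosBump_eq_zero hd h h1
    rw [deriv_cosBump_comp_eq_zero hz, hz,
      indicator_of_mem (show w t ∈ Icc (d / 2) d from ⟨h, h1⟩)]
    simp
  · rw [indicator_of_notMem (fun hm => absurd hm.1 (not_le.2 h)),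
      cosBump_eq_cos hd (h0 t ⟨ht.1.le, ht.2.le⟩) h.le]
    have hcont : ContinuousAt w t := hw.continuousOn.continuousAt hnhds
    have heq : cosBump d ∘ w =ᶠ[nhds t] (fun x => Real.cos (Real.pi / d * x)) ∘ w := by
      filter_upwards [hcont.eventually_lt_const h, hnhds] with x hx hx'
      exact cosBump_eq_cos hd (h0 x hx') hx.le
    have hder : HasDerivAt (fun x => Real.cos (Real.pi / d * x))
        (-Real.sin (Real.pi / d * w t) * (Real.pi / d * 1)) (w t) :=
      ((hasDerivAt_id (w t)).const_mul (Real.pi / d)).cos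
    have hb := abs_deriv_comp_le_of_lipschitzOnWith hw hnhds hder.differentiableAt
    rw [hder.deriv] at hb
    rw [heq.deriv_eq]
    refine (sq_le_sq.2 hb).trans (le_of_eq ?_)
    rw [sub_zero, ← Real.sin_sq]
    ring

theorem Real.sInf_le_of_mem_of_nonneg {s : Set ℝ} {a : ℝ} (ha : a ∈ s) (h0 : 0 ≤ a) :
    sInf s ≤ a := by
  by_cases hb : BddBelow s
  · exact csInf_le hb ha
  · rwa [Real.sInf_of_not_bddBelow hb]

namespace MetricGraphOn

variable {X : Type} [MetricSpace X]

theorem subgraphSet_univ (G : MetricGraphOn X) : G.subgraphSet univ = univ := by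
  refine eq_univ_of_forall fun x => ?_
  obtain ⟨e, t, ht, rfl⟩ := G.cover x
  exact mem_biUnion (mem_univ e) ⟨t, ht, rfl⟩

theorem abs_edgeDeriv_le (G : MetricGraphOn X) {f : X → ℝ} {C : NNReal} {e : G.E}
    (hlip : LipschitzOnWith C (f ∘ G.edgeMap e) (Icc 0 (G.len e))) {t : ℝ}
    (ht : t ∈ Ioo 0 (G.len e)) : |G.edgeDeriv f e t| ≤ C := by
  simpa [edgeDeriv] using norm_deriv_le_of_lipschitzOn (Icc_mem_nhds ht.1 ht.2) hlip

theorem integrableOn_edgeDeriv_sq (G : MetricGraphOn X) {f : X → ℝ} {C : NNReal} {e : G.E}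
    (hlip : LipschitzOnWith C (f ∘ G.edgeMap e) (Icc 0 (G.len e))) :
    IntegrableOn (fun t => G.edgeDeriv f e t ^ 2) (Ioo 0 (G.len e)) := by
  refine Integrable.of_bound ((measurable_deriv _).pow_const 2).aestronglyMeasurable
    ((C : ℝ) ^ 2) ((ae_restrict_iff' measurableSet_Ioo).2 (ae_of_all _ fun t ht => ?_))
  rw [Real.norm_of_nonneg (sq_nonneg _)]
  exact sq_le_sq' (abs_le.1 (G.abs_edgeDeriv_le hlip ht)).1 (abs_le.1 (G.abs_edgeDeriv_le hlip ht)).2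

theorem summable_edgeEnergy (G : MetricGraphOn X) (hsum : Summable G.len) {f : X → ℝ}
    {C : NNReal} (hlip : ∀ e, LipschitzOnWith C (f ∘ G.edgeMap e) (Icc 0 (G.len e))) :
    Summable (G.edgeEnergy f) :=
  summable_setIntegral_Ioo G.len_pos hsum (C := (C : ℝ) ^ 2) (fun _ _ _ => sq_nonneg _)
    fun e _ ht => sq_le_sq' (abs_le.1 (G.abs_edgeDeriv_le (hlip e) ht)).1
      (abs_le.1 (G.abs_edgeDeriv_le (hlip e) ht)).2

theorem summable_edgeMass (G : MetricGraphOn X) (hsum : Summable G.len) {f : X → ℝ} {B : ℝ}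
    (hB : ∀ x, |f x| ≤ B) : Summable (G.edgeMass f) :=
  summable_setIntegral_Ioo G.len_pos hsum (C := B ^ 2) (fun _ _ _ => sq_nonneg _)
    fun _ _ _ => sq_le_sq' (abs_le.1 (hB _)).1 (abs_le.1 (hB _)).2

theorem integrableOn_edgeMap_sq (G : MetricGraphOn X) {f : X → ℝ} (hf : Continuous f)
    (e : G.E) : IntegrableOn (fun t => f (G.edgeMap e t) ^ 2) (Ioo 0 (G.len e)) :=
  (((hf.comp_continuousOn (G.edgeMap_cont e)).pow 2).integrableOn_Icc).mono_set
    Ioo_subset_Icc_self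

/-- A bounded continuous function which is edgewise Lipschitz with a common constant belongs
to `H¹` as soon as the total length is finite. -/
theorem memH1_of_lipschitz (G : MetricGraphOn X) (hsum : Summable G.len) {f : X → ℝ}
    {B : ℝ} {C : NNReal} (hf : Continuous f) (hB : ∀ x, |f x| ≤ B)
    (hlip : ∀ e, LipschitzOnWith C (f ∘ G.edgeMap e) (Icc 0 (G.len e))) : G.MemH1 f := by
  refine ⟨hf, hf.continuousOn, fun e _ => G.integrableOn_edgeDeriv_sq (hlip e),
    fun e _ t ht => ?_, ?_⟩
  · have hac : AbsolutelyContinuousOnInterval (f ∘ G.edgeMap e) 0 t :=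
      ((hlip e).mono (by rw [uIcc_of_le ht.1]; exact Icc_subset_Icc_right ht.2)
        ).absolutelyContinuousOnInterval
    have h := hac.integral_deriv_eq_sub
    rw [intervalIntegral.integral_of_le ht.1, integral_Ioc_eq_integral_Ioo] at h
    simp only [edgeDeriv, h, Function.comp]
    ring
  · exact ((G.summable_edgeMass hsum hB).add (G.summable_edgeEnergy hsum hlip)).comp_injective
      Subtype.val_injective

theorem lipschitzOnWith_cosBump_comp (G : MetricGraphOn X) {d : ℝ} (hd : 0 < d) {u : X → ℝ}
    {e : G.E} (hu : LipschitzOnWith 1 (u ∘ G.edgeMap e) (Icc 0 (G.len e))) :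
    LipschitzOnWith (Real.pi / d).toNNReal ((cosBump d ∘ u) ∘ G.edgeMap e)
      (Icc 0 (G.len e)) := by
  refine LipschitzOnWith.of_dist_le_mul fun s hs t ht => ?_
  have hpi : 0 ≤ Real.pi / d := (div_pos Real.pi_pos hd).le
  rw [Real.coe_toNNReal _ hpi]
  refine (abs_cosBump_sub_cosBump_le hd _ _).trans (mul_le_mul_of_nonneg_left ?_ hpi)
  simpa [Real.dist_eq] using hu.dist_le_mul s hs t ht

/-- The Rayleigh quotient estimate for the profile `cosBump d` of an edgewise `1`-Lipschitz
function onto `[0, d]`. -/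
theorem rayleigh_cosBump_comp (G : MetricGraphOn X) (hsum : Summable G.len) {d : ℝ}
    (hd : 0 < d) {u : X → ℝ}
    (hlip : ∀ e, LipschitzOnWith 1 (u ∘ G.edgeMap e) (Icc 0 (G.len e)))
    (h0 : ∀ x, 0 ≤ u x) (h1 : ∀ x, u x ≤ d) (hsurj : Icc 0 d ⊆ range u) :
    0 ≤ Real.pi ^ 2 / d ^ 2 * ((4 * (∑' e, G.len e) - 3 * d) / d) ∧
      ∑' e, G.edgeEnergy (cosBump d ∘ u) e ≤
        Real.pi ^ 2 / d ^ 2 * ((4 * (∑' e, G.len e) - 3 * d) / d) *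
          ∑' e, G.edgeMass (cosBump d ∘ u) e := by
  have := G.countableE
  have hcov : Icc 0 d ⊆ ⋃ e, (u ∘ G.edgeMap e) '' Icc 0 (G.len e) := by
    intro y hy
    obtain ⟨x, rfl⟩ := hsurj hy
    obtain ⟨e, t, ht, rfl⟩ := G.cover x
    exact mem_iUnion.2 ⟨e, t, ht, rfl⟩
  have hfin : volume (Icc 0 d) ≠ ∞ := by simp
  have hgM : Measurable fun x => cosBump d x ^ 2 := ((continuous_cosBump d).pow 2).measurable
  have hgM1 : ∀ x, cosBump d x ^ 2 ≤ 1 := fun x =>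
    pow_le_one₀ (cosBump_nonneg d x) (cosBump_le_one d x)
  have hgI : Measurable ((Icc (d / 2) d).indicator (1 : ℝ → ℝ)) :=
    measurable_one.indicator measurableSet_Icc
  have hgI0 : ∀ x, 0 ≤ (Icc (d / 2) d).indicator (1 : ℝ → ℝ) x :=
    indicator_nonneg fun _ _ => zero_le_one
  have hgI1 : ∀ x, (Icc (d / 2) d).indicator (1 : ℝ → ℝ) x ≤ 1 := fun x =>
    indicator_le_self' (fun _ _ => zero_le_one) x
  set M := ∑' e, G.edgeMass (cosBump d ∘ u) e
  set I := ∑' e, ∫ t in Ioo 0 (G.len e),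
    (Icc (d / 2) d).indicator (1 : ℝ → ℝ) ((u ∘ G.edgeMap e) t)
  set L := ∑' e, G.len e
  have hM : d / 4 ≤ M := (integral_cosBump_sq hd).trans
    (setIntegral_le_tsum_setIntegral_comp G.len_pos hsum hfin hlip hcov hgM
      (fun _ => sq_nonneg _) hgM1)
  have hI : d / 2 ≤ I := by
    refine le_trans (le_of_eq ?_)
      (setIntegral_le_tsum_setIntegral_comp G.len_pos hsum hfin hlip hcov hgI hgI0 hgI1)
    rw [setIntegral_indicator measurableSet_Icc, Icc_inter_Icc, max_eq_right (by linarith),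
      min_self]
    simp
    rw [max_eq_left (by linarith)]
    ring
  have hsM : Summable (G.edgeMass (cosBump d ∘ u)) := G.summable_edgeMass hsum (B := 1)
    fun x => by simpa [abs_of_nonneg (cosBump_nonneg d (u x))] using cosBump_le_one d (u x)
  have hsI := summable_setIntegral_Ioo G.len_pos hsum (C := 1)
    (f := fun e t => (Icc (d / 2) d).indicator (1 : ℝ → ℝ) ((u ∘ G.edgeMap e) t))
    (fun _ _ _ => hgI0 _) (fun _ _ _ => hgI1 _)
  have hsE := G.summable_edgeEnergy hsum fun e => G.lipschitzOnWith_cosBump_comp hd (hlip e)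
  have hE : ∑' e, G.edgeEnergy (cosBump d ∘ u) e ≤ (Real.pi / d) ^ 2 * (L - I - M) := by
    rw [← hsum.tsum_sub hsI, ← (hsum.sub hsI).tsum_sub hsM, ← tsum_mul_left]
    refine hsE.tsum_le_tsum (fun e => ?_) (((hsum.sub hsI).sub hsM).mul_left _)
    have hiI := integrableOn_comp_of_lipschitzOnWith (hlip e) hgI hgI0 hgI1
    have hiM := integrableOn_comp_of_lipschitzOnWith (hlip e) hgM (fun _ => sq_nonneg _) hgM1
    have h1i : IntegrableOn (fun _ : ℝ => (1 : ℝ)) (Ioo 0 (G.len e)) := by simp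
    have hone : ∫ _ in Ioo 0 (G.len e), (1 : ℝ) = G.len e := by simp [(G.len_pos e).le]
    have hbound : G.edgeEnergy (cosBump d ∘ u) e ≤ ∫ t in Ioo 0 (G.len e),
        (Real.pi / d) ^ 2 * (1 - (Icc (d / 2) d).indicator 1 ((u ∘ G.edgeMap e) t) -
          cosBump d ((u ∘ G.edgeMap e) t) ^ 2) :=
      setIntegral_mono_on (G.integrableOn_edgeDeriv_sq (G.lipschitzOnWith_cosBump_comp hd (hlip e)))
        (((h1i.sub hiI).sub hiM).const_mul _) measurableSet_Ioo fun t ht =>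
          sq_deriv_cosBump_comp_le hd (hlip e) ht (fun _ _ => h0 _) (h1 _)
    refine hbound.trans (le_of_eq ?_)
    have h1I : IntegrableOn (fun t => 1 - (Icc (d / 2) d).indicator (1 : ℝ → ℝ)
      ((u ∘ G.edgeMap e) t)) (Ioo 0 (G.len e)) := h1i.sub hiI
    rw [integral_const_mul, integral_sub h1I hiM, integral_sub h1i hiI, hone]
    rfl
  have hE0 : 0 ≤ ∑' e, G.edgeEnergy (cosBump d ∘ u) e :=
    tsum_nonneg fun e => integral_nonneg fun t => sq_nonneg _
  have hK : 0 < (Real.pi / d) ^ 2 := pow_pos (div_pos Real.pi_pos hd) 2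
  have hpos : 0 ≤ L - I - M := nonneg_of_mul_nonneg_right (hE0.trans hE) hK
  refine ⟨?_, hE.trans ?_⟩
  · exact mul_nonneg (by positivity) (div_nonneg (by linarith) hd.le)
  · rw [← div_pow, mul_assoc]
    refine mul_le_mul_of_nonneg_left ?_ hK.le
    rw [div_mul_eq_mul_div, le_div_iff₀ hd]
    nlinarith [mul_le_mul_of_nonneg_left hM (show 0 ≤ 4 * L - 2 * d by linarith)]

theorem edgeMass_add_of_mul_eq_zero (G : MetricGraphOn X) {f g : X → ℝ} (hf : Continuous f)
    (hg : Continuous g) (hfg : ∀ x, f x * g x = 0) (a b : ℝ) (e : G.E) :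
    G.edgeMass (a • f + b • g) e = a ^ 2 * G.edgeMass f e + b ^ 2 * G.edgeMass g e := by
  unfold edgeMass
  rw [← integral_const_mul, ← integral_const_mul,
    ← integral_add ((G.integrableOn_edgeMap_sq hf e).const_mul _)
      ((G.integrableOn_edgeMap_sq hg e).const_mul _)]
  refine integral_congr_ae (ae_of_all _ fun t => ?_)
  simp only [Pi.add_apply, Pi.smul_apply, smul_eq_mul]
  linear_combination 2 * a * b * hfg (G.edgeMap e t)

theorem edgeEnergy_add_of_mul_eq_zero (G : MetricGraphOn X) {f g : X → ℝ} {C : NNReal}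
    {e : G.E} (hf : LipschitzOnWith C (f ∘ G.edgeMap e) (Icc 0 (G.len e)))
    (hg : LipschitzOnWith C (g ∘ G.edgeMap e) (Icc 0 (G.len e))) (hf0 : ∀ x, 0 ≤ f x)
    (hg0 : ∀ x, 0 ≤ g x) (hfg : ∀ x, f x * g x = 0) (a b : ℝ) :
    G.edgeEnergy (a • f + b • g) e = a ^ 2 * G.edgeEnergy f e + b ^ 2 * G.edgeEnergy g e := by
  have hdf := hf.ae_differentiableWithinAt_of_mem_real
  have hdg := hg.ae_differentiableWithinAt_of_mem_real
  unfold edgeEnergy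
  rw [← integral_const_mul, ← integral_const_mul,
    ← integral_add ((G.integrableOn_edgeDeriv_sq hf).const_mul _)
      ((G.integrableOn_edgeDeriv_sq hg).const_mul _)]
  refine integral_congr_ae ((ae_restrict_iff' measurableSet_Ioo).2 ?_)
  filter_upwards [hdf, hdg] with t hft hgt ht
  have hn := Icc_mem_nhds ht.1 ht.2
  have hft' := (hft ⟨ht.1.le, ht.2.le⟩).differentiableAt hn
  have hgt' := (hgt ⟨ht.1.le, ht.2.le⟩).differentiableAt hn
  have hadd : G.edgeDeriv (a • f + b • g) e t =
      a * G.edgeDeriv f e t + b * G.edgeDeriv g e t :=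
    ((hft'.hasDerivAt.const_mul a).add (hgt'.hasDerivAt.const_mul b)).deriv
  have hmin : ∀ {h : X → ℝ}, (∀ x, 0 ≤ h x) → h (G.edgeMap e t) = 0 → G.edgeDeriv h e t = 0 :=
    fun hh hz => IsLocalMin.deriv_eq_zero (Eventually.of_forall fun x => by
      simpa [hz] using hh (G.edgeMap e x))
  have hprod : G.edgeDeriv f e t * G.edgeDeriv g e t = 0 := by
    rcases mul_eq_zero.1 (hfg (G.edgeMap e t)) with h | h
    · rw [hmin hf0 h, zero_mul]
    · rw [hmin hg0 h, mul_zero]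
  simp only [hadd]
  linear_combination 2 * a * b * hprod

theorem neumannEigen_two_le_of_dist (G : MetricGraphOn X) [ConnectedSpace X]
    (hsum : Summable G.len) (x y : X) (hxy : 0 < dist x y) :
    G.neumannEigen 2 ≤ Real.pi ^ 2 / dist x y ^ 2 *
      ((4 * (∑' e, G.len e) - 3 * dist x y) / dist x y) := by
  set d := dist x y with hd
  set u : X → ℝ := fun z => min (dist x z) d with hu
  set v : X → ℝ := fun z => d - u z with hv
  have hucont : Continuous u := by fun_prop
  have hvcont : Continuous v := by fun_prop
  have hu0 : ∀ z, 0 ≤ u z := fun z => le_min dist_nonneg hxy.le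
  have hud : ∀ z, u z ≤ d := fun z => min_le_right _ _
  have hux : u x = 0 := by simp [hu, hxy.le]
  have huy : u y = d := by simp [hu, hd]
  have hv0 : ∀ z, 0 ≤ v z := fun z => sub_nonneg.2 (hud z)
  have hvd : ∀ z, v z ≤ d := fun z => sub_le_self _ (hu0 z)
  have hulip : ∀ e, LipschitzOnWith 1 (u ∘ G.edgeMap e) (Icc 0 (G.len e)) := fun e =>
    LipschitzOnWith.of_dist_le_mul fun s hs t ht => by
      rw [NNReal.coe_one, one_mul, Real.dist_eq, Real.dist_eq]
      refine (abs_min_sub_min_le_max _ _ _ _).trans ?_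
      rw [sub_self, abs_zero, max_eq_left (abs_nonneg _), dist_comm x, dist_comm x]
      exact (abs_dist_sub_le _ _ _).trans (G.dist_le e s hs t ht)
  have hvlip : ∀ e, LipschitzOnWith 1 (v ∘ G.edgeMap e) (Icc 0 (G.len e)) := fun e =>
    LipschitzOnWith.of_dist_le_mul fun s hs t ht => by
      simpa only [hv, Function.comp, dist_sub_left] using (hulip e).dist_le_mul s hs t ht
  have husurj : Icc 0 d ⊆ range u := hux ▸ huy ▸ intermediate_value_univ x y hucont
  have hvsurj : Icc 0 d ⊆ range v := fun z hz => by
    obtain ⟨p, hp⟩ := husurj (show d - z ∈ Icc 0 d from ⟨by linarith [hz.2], by linarith [hz.1]⟩)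
    exact ⟨p, by simp [hv, hp]⟩
  obtain ⟨hK, hEu⟩ := G.rayleigh_cosBump_comp hsum hxy hulip hu0 hud husurj
  obtain ⟨-, hEv⟩ := G.rayleigh_cosBump_comp hsum hxy hvlip hv0 hvd hvsurj
  set f := cosBump d ∘ u with hf
  set g := cosBump d ∘ v with hg
  have hfcont : Continuous f := (continuous_cosBump d).comp hucont
  have hgcont : Continuous g := (continuous_cosBump d).comp hvcont
  have hflip := fun e => G.lipschitzOnWith_cosBump_comp hxy (hulip e)
  have hglip := fun e => G.lipschitzOnWith_cosBump_comp hxy (hvlip e)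
  have habs : ∀ z, |cosBump d z| ≤ 1 := fun z => by
    rw [abs_of_nonneg (cosBump_nonneg d z)]; exact cosBump_le_one d z
  have hfg : ∀ z, f z * g z = 0 := fun z => by
    rcases le_total (d / 2) (u z) with h | h
    · rw [hf, Function.comp, cosBump_eq_zero hxy h (hud z), zero_mul]
    · rw [hg, Function.comp, cosBump_eq_zero hxy (t := v z) (by simp only [hv]; linarith) (hvd z),
        mul_zero]
  have hfx : f x = 1 := by simp [hf, hux, cosBump]
  have hgy : g y = 1 := by simp [hg, hv, huy, cosBump]
  have hgx : g x = 0 := by simpa [hfx] using hfg x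
  have hfy : f y = 0 := by simpa [hgy] using hfg y
  refine Real.sInf_le_of_mem_of_nonneg ⟨![f, g], ?_, ?_, fun c => ?_⟩ hK
  · rw [Fin.forall_fin_two]
    exact ⟨G.memH1_of_lipschitz hsum hfcont (fun z => habs _) hflip,
      G.memH1_of_lipschitz hsum hgcont (fun z => habs _) hglip⟩
  · have hpair : LinearIndependent ℝ
        ![(G.subgraphSet univ).domRestrict f, (G.subgraphSet univ).domRestrict g] := by
      rw [LinearIndependent.pair_iff]
      intro a b hab
      have hmem : ∀ z, z ∈ G.subgraphSet univ := fun z => G.subgraphSet_univ ▸ mem_univ z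
      have hax : a * f x + b * g x = 0 := congrFun hab ⟨x, hmem x⟩
      have hby : a * f y + b * g y = 0 := congrFun hab ⟨y, hmem y⟩
      exact ⟨by simpa [hfx, hgx] using hax, by simpa [hfy, hgy] using hby⟩
    convert hpair using 1
    ext i
    fin_cases i <;> rfl
  · have hsum2 : ∑ i, c i • ![f, g] i = c 0 • f + c 1 • g := by simp [Fin.sum_univ_two]
    have hsMf : Summable (G.edgeMass f) := G.summable_edgeMass hsum fun z => habs _
    have hsMg : Summable (G.edgeMass g) := G.summable_edgeMass hsum fun z => habs _
    have hsEf : Summable (G.edgeEnergy f) := G.summable_edgeEnergy hsum hflip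
    have hsEg : Summable (G.edgeEnergy g) := G.summable_edgeEnergy hsum hglip
    have hM : G.l2normSqOn univ (c 0 • f + c 1 • g) =
        c 0 ^ 2 * ∑' e, G.edgeMass f e + c 1 ^ 2 * ∑' e, G.edgeMass g e := by
      rw [l2normSqOn, tsum_univ, ← tsum_mul_left, ← tsum_mul_left,
        ← (hsMf.mul_left _).tsum_add (hsMg.mul_left _)]
      exact tsum_congr fun e => G.edgeMass_add_of_mul_eq_zero hfcont hgcont hfg _ _ e
    have hE : G.derivNormSqOn univ (c 0 • f + c 1 • g) =
        c 0 ^ 2 * ∑' e, G.edgeEnergy f e + c 1 ^ 2 * ∑' e, G.edgeEnergy g e := by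
      rw [derivNormSqOn, tsum_univ, ← tsum_mul_left, ← tsum_mul_left,
        ← (hsEf.mul_left _).tsum_add (hsEg.mul_left _)]
      exact tsum_congr fun e => G.edgeEnergy_add_of_mul_eq_zero (hflip e) (hglip e)
        (fun z => cosBump_nonneg d _) (fun z => cosBump_nonneg d _) hfg _ _
    rw [hsum2, hM, hE]
    nlinarith [mul_le_mul_of_nonneg_left hEu (sq_nonneg (c 0)),
      mul_le_mul_of_nonneg_left hEv (sq_nonneg (c 1))]

end MetricGraphOn

open MetricGraphOn in
/-- Let `G` be a locally finite, connected metric graph with finite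
total length `L > 0`, finite diameter `D > 0` and finite Betti number. Then
`μ_2(G) ≤ (π²/D²) · (4L − 3D)/D`. -/
theorem statement18 (X : Type) [MetricSpace X] (G : MetricGraphOn X)
    (hlf : G.LocallyFinite) (hconn : ConnectedSpace X)
    (hsum : Summable G.len) (L : ℝ) (hL : L = ∑' e : G.E, G.len e) (hLpos : 0 < L)
    (hbdd : Bornology.IsBounded (Set.univ : Set X))
    (D : ℝ) (hD : D = Metric.diam (Set.univ : Set X)) (hDpos : 0 < D)
    (hbetti : ∃ β : ℕ, G.HasBettiNumber β) :
    G.neumannEigen 2 ≤ Real.pi ^ 2 / D ^ 2 * ((4 * L - 3 * D) / D) := by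
  have hlim : Tendsto (fun d : ℝ => Real.pi ^ 2 / d ^ 2 * ((4 * L - 3 * d) / d)) (nhds D)
      (nhds (Real.pi ^ 2 / D ^ 2 * ((4 * L - 3 * D) / D))) := by
    have hc : ContinuousAt (fun d : ℝ => Real.pi ^ 2 / d ^ 2 * ((4 * L - 3 * d) / d)) D := by
      have := hDpos.ne'
      fun_prop (disch := positivity)
    exact hc
  refine ge_of_tendsto_of_frequently hlim (frequently_iff.2 fun {U} hU => ?_)
  obtain ⟨a, ha, haU⟩ := exists_Ioc_subset_of_mem_nhds hU ⟨0, hDpos⟩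
  obtain ⟨x, y, hxy⟩ : ∃ x y : X, max a 0 < dist x y := by
    by_contra! h
    exact absurd (Metric.diam_le_of_forall_dist_le (le_max_right a 0) fun x _ y _ => h x y)
      (not_le.2 (hD ▸ max_lt ha hDpos))
  rw [max_lt_iff] at hxy
  refine ⟨dist x y, haU ⟨hxy.1, ?_⟩, ?_⟩
  · exact hD ▸ Metric.dist_le_diam_of_mem hbdd (mem_univ x) (mem_univ y)
  · rw [hL]
    exact G.neumannEigen_two_le_of_dist hsum x y hxy.2
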